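/- Structure of left ideals of R: for every R-submodule I of R, either (1) there exists p ∈ K[x] with p(0) ≠ 0 such that I is a direct summand of the left ideal Submodule.span R {p(c)}, i.e. I ≤ Submodule.span R {p(c)} and there exists an R-submodule B ≤ Submodule.span R {p(c)} with I ⊓ B = ⊥ and I ⊔ B = Submodule.span R {p(c)}; or (2) I is a direct summand of J, i.e. I ≤ J and there exists an R-submodule B ≤ J with I ⊓ B = ⊥ and I ⊔ B = J. -/

import Mathlib

noncomputable section

/-- The defining relation `X * Y = 1` of the Jacobson algebra. -/
inductive JRel (K : Type*) [Field K] : FreeAlgebra K (Fin 2) → FreeAlgebra K (Fin 2) → Prop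
  | rel : JRel K (FreeAlgebra.ι K 0 * FreeAlgebra.ι K 1) 1

/-- The Jacobson algebra `K⟨X, Y | XY = 1⟩`. -/
abbrev Jacobson (K : Type*) [Field K] := RingQuot (JRel K)

variable (K : Type*) [Field K]

/-- The generator `X` of the Jacobson algebra. -/
def Xg : Jacobson K := RingQuot.mkAlgHom K (JRel K) (FreeAlgebra.ι K 0)

/-- The generator `Y` of the Jacobson algebra. -/
def Yg : Jacobson K := RingQuot.mkAlgHom K (JRel K) (FreeAlgebra.ι K 1)

/-- The loop `c = Y²X`. -/
def cJ : Jacobson K := Yg K ^ 2 * Xg K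

/-- `F` is the set of irreducible polynomials `f ∈ K[x]` with `f(0) = -1`. -/
def FSet : Set (Polynomial K) := {f | Irreducible f ∧ f.eval 0 = -1}

/-- The vertex idempotent `w = 1 - YX`. -/
def wJ : Jacobson K := 1 - Yg K * Xg K

/-- The ghost loop `c* = YX²`. -/
def csJ : Jacobson K := Yg K * Xg K ^ 2

/-- The ghost exit edge `d* = X - YX²`. -/
def dsJ : Jacobson K := Xg K - Yg K * Xg K ^ 2

/-- The socle of the Jacobson algebra, as a left ideal:
`J = span_R ({w} ∪ {ds * cs^j : j ∈ ℕ})`. -/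
def socJ : Submodule (Jacobson K) (Jacobson K) :=
  Submodule.span (Jacobson K) ({wJ K} ∪ Set.range fun j : ℕ => dsJ K * csJ K ^ j)

theorem JX_mul_Y : Xg K * Yg K = 1 := by
  unfold Xg Yg
  rw [← map_mul, RingQuot.mkAlgHom_rel K JRel.rel, map_one]

theorem JX_mul_Y_mul (a : Jacobson K) : Xg K * (Yg K * a) = a := by
  rw [← mul_assoc, JX_mul_Y, one_mul]

theorem J_induction {P : Jacobson K → Prop} (hs : ∀ a : K, P (algebraMap K _ a))
    (hX : P (Xg K)) (hY : P (Yg K)) (ha : ∀ a b, P a → P b → P (a + b))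
    (hm : ∀ a b, P a → P b → P (a * b)) (r : Jacobson K) : P r := by
  obtain ⟨f, rfl⟩ := RingQuot.mkAlgHom_surjective K (JRel K) r
  induction f using FreeAlgebra.induction with
  | grade0 a => simpa using hs a
  | grade1 i =>
    fin_cases i
    · exact hX
    · exact hY
  | mul a b h1 h2 => rw [map_mul]; exact hm _ _ h1 h2
  | add a b h1 h2 => rw [map_add]; exact ha _ _ h1 h2

theorem Jsub_smul {L : Submodule (Jacobson K) (Jacobson K)} (k : K) {a : Jacobson K}
    (h : a ∈ L) : algebraMap K (Jacobson K) k * a ∈ L := L.smul_mem _ h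

theorem J_simple_aux (v : Jacobson K) (hv : Xg K * v = 0) (r : Jacobson K) :
    ∃ q : Polynomial K, r * v = Polynomial.aeval (Yg K) q * v := by
  have hXY := JX_mul_Y K
  have key : ∀ s : Jacobson K, (∃ q : Polynomial K, s * v = Polynomial.aeval (Yg K) q * v) →
      ∃ q : Polynomial K, r * s * v = Polynomial.aeval (Yg K) q * v := by
    induction r using J_induction with
    | hs a =>
      rintro s ⟨q, hq⟩
      exact ⟨Polynomial.C a * q, by rw [mul_assoc, hq, map_mul, Polynomial.aeval_C, mul_assoc]⟩
    | hY =>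
      rintro s ⟨q, hq⟩
      exact ⟨Polynomial.X * q, by rw [mul_assoc, hq, map_mul, Polynomial.aeval_X, mul_assoc]⟩
    | hX =>
      rintro s ⟨q, hq⟩
      refine ⟨q.divX, ?_⟩
      rw [mul_assoc, hq]
      conv_lhs => rw [← Polynomial.X_mul_divX_add q]
      rw [map_add, map_mul, Polynomial.aeval_X, Polynomial.aeval_C, add_mul, mul_add,
        mul_assoc (Yg K), JX_mul_Y_mul, ← mul_assoc (Xg K), ← Algebra.commutes,
        mul_assoc _ (Xg K), hv, mul_zero, add_zero]
    | ha a b h1 h2 =>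
      intro s hs
      obtain ⟨q1, h1⟩ := h1 s hs
      obtain ⟨q2, h2⟩ := h2 s hs
      exact ⟨q1 + q2, by rw [add_mul, add_mul, h1, h2, map_add, add_mul]⟩
    | hm a b h1 h2 =>
      intro s hs
      obtain ⟨q, hq⟩ := h1 _ (h2 s hs)
      exact ⟨q, by rw [← hq]; simp only [mul_assoc]⟩
  simpa using key 1 ⟨1, by simp⟩

theorem J_simple_aux2 (v : Jacobson K) (hv : Xg K * v = 0)
    (L : Submodule (Jacobson K) (Jacobson K)) (n : ℕ) : ∀ q : Polynomial K, q.natDegree = n →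
    q ≠ 0 → Polynomial.aeval (Yg K) q * v ∈ L → v ∈ L := by
  have hXY := JX_mul_Y K
  induction n with
  | zero =>
    intro q hq h0 h
    obtain ⟨a, rfl⟩ := Polynomial.natDegree_eq_zero.1 hq
    have ha : a ≠ 0 := by rintro rfl; simp at h0
    rw [Polynomial.aeval_C] at h
    have := Jsub_smul K a⁻¹ h
    rwa [← mul_assoc, ← map_mul, inv_mul_cancel₀ ha, map_one, one_mul] at this
  | succ n ih =>
    intro q hq h0 h
    refine ih q.divX (by rw [Polynomial.natDegree_divX_eq_natDegree_tsub_one, hq]; rfl) ?_ ?_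
    · intro h
      rw [Polynomial.divX_eq_zero_iff] at h
      rw [h] at hq
      simp at hq
    · have h2 := L.smul_mem (Xg K) h
      rw [smul_eq_mul, ← Polynomial.X_mul_divX_add q, map_add, map_mul, Polynomial.aeval_X,
        Polynomial.aeval_C, add_mul, mul_add, mul_assoc (Yg K), ← mul_assoc (Xg K) (Yg K),
        hXY, one_mul, ← mul_assoc (Xg K), ← Algebra.commutes, mul_assoc _ (Xg K), hv,
        mul_zero, add_zero] at h2
      exact h2

theorem J_ss (v : Jacobson K) (hv : Xg K * v = 0) :
    IsSemisimpleModule (Jacobson K) (Submodule.span (Jacobson K) {v}) := by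
  have key : ∀ L : Submodule (Jacobson K) (Jacobson K), L ≤ Submodule.span (Jacobson K) {v} →
      L = ⊥ ∨ L = Submodule.span (Jacobson K) {v} := by
    intro L hL
    by_cases h : L = ⊥
    · exact Or.inl h
    right
    obtain ⟨a, haL, ha⟩ := Submodule.exists_mem_ne_zero_of_ne_bot h
    obtain ⟨r, rfl⟩ := Submodule.mem_span_singleton.1 (hL haL)
    obtain ⟨q, hq⟩ := J_simple_aux K v hv r
    rw [smul_eq_mul, hq] at haL ha
    refine le_antisymm hL ?_
    rw [Submodule.span_singleton_le_iff_mem]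
    refine J_simple_aux2 K v hv L _ q rfl ?_ haL
    rintro rfl
    simp at ha
  refine (isSemisimpleModule_iff _ _).2 ⟨fun M => ?_⟩
  have hM := key (M.map (Submodule.subtype _)) (Submodule.map_subtype_le _ _)
  rcases hM with h | h
  · refine ⟨⊤, ?_⟩
    have h' : M = ⊥ := by
      apply Submodule.map_injective_of_injective (Submodule.subtype_injective _)
      rw [h]; simp
    rw [h']; exact isCompl_bot_top
  · refine ⟨⊥, ?_⟩
    have : M = ⊤ := by
      apply Submodule.map_injective_of_injective (Submodule.subtype_injective _)
      rw [h]; simp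
    rw [this]; exact isCompl_top_bot

theorem JX_mul_w : Xg K * wJ K = 0 := by
  unfold wJ
  rw [mul_sub, ← mul_assoc, JX_mul_Y]; simp

theorem Jw_mul_Y : wJ K * Yg K = 0 := by
  unfold wJ
  rw [sub_mul, mul_assoc, JX_mul_Y]; simp

theorem JX_cs (j : ℕ) : dsJ K * csJ K ^ j = wJ K * Xg K ^ (j + 1) := by
  have h : ∀ j : ℕ, Xg K * csJ K ^ j = Xg K ^ (j + 1) := by
    intro j
    induction j with
    | zero => simp
    | succ j ih =>
      rw [pow_succ, ← mul_assoc, ih, csJ, pow_succ (Xg K) j, mul_assoc, JX_mul_Y_mul, ← pow_add]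
  have : dsJ K = wJ K * Xg K := by
    unfold dsJ wJ; rw [sub_mul, one_mul, pow_two, mul_assoc]
  rw [this, mul_assoc, h]

theorem socJ_eq : socJ K = Submodule.span (Jacobson K) (Set.range fun j : ℕ => wJ K * Xg K ^ j) := by
  unfold socJ
  congr 1
  ext a
  constructor
  · rintro (h | ⟨j, rfl⟩)
    · exact ⟨0, by simpa using h.symm⟩
    · exact ⟨j + 1, (JX_cs K j).symm⟩
  · rintro ⟨j, rfl⟩
    cases j with
    | zero => left; simp
    | succ j => right; exact ⟨j, JX_cs K j⟩

theorem wX_mem (j : ℕ) : wJ K * Xg K ^ j ∈ socJ K := by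
  rw [socJ_eq]; exact Submodule.subset_span ⟨j, rfl⟩

theorem socJ_ss : IsSemisimpleModule (Jacobson K) (socJ K) := by
  rw [socJ_eq, Submodule.span_range_eq_iSup]
  have := isSemisimpleModule_biSup_of_isSemisimpleModule_submodule (s := Set.univ)
    (p := fun j : ℕ => Submodule.span (Jacobson K) {wJ K * Xg K ^ j})
    (fun j _ => J_ss K _ (by rw [← mul_assoc, JX_mul_w, zero_mul]))
  have e : (⨆ j ∈ (Set.univ : Set ℕ), Submodule.span (Jacobson K) {wJ K * Xg K ^ j}) =
      ⨆ j : ℕ, Submodule.span (Jacobson K) {wJ K * Xg K ^ j} := iSup_congr fun j => by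
    rw [iSup_pos (Set.mem_univ j)]
  rw [← e]
  exact this

theorem socJ_mul (r : Jacobson K) : ∀ a ∈ socJ K, a * r ∈ socJ K := by
  have gen : ∀ r : Jacobson K, (∀ j, wJ K * Xg K ^ j * r ∈ socJ K) →
      ∀ a ∈ socJ K, a * r ∈ socJ K := by
    intro r h a ha
    rw [socJ_eq] at ha
    induction ha using Submodule.span_induction with
    | mem x hx => obtain ⟨j, rfl⟩ := hx; exact h j
    | zero => simp
    | add x y _ _ h1 h2 => rw [add_mul]; exact add_mem h1 h2
    | smul b x _ h => rw [smul_mul_assoc]; exact Submodule.smul_mem _ _ h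
  induction r using J_induction with
  | hs k => intro a ha; rw [← Algebra.commutes]; exact Jsub_smul K k ha
  | hX => exact gen _ fun j => by rw [mul_assoc, ← pow_succ]; exact wX_mem K _
  | hY =>
    refine gen _ fun j => ?_
    cases j with
    | zero => simp [Jw_mul_Y]
    | succ j => rw [pow_succ, mul_assoc, mul_assoc, JX_mul_Y, mul_one]; exact wX_mem K _
  | ha a b h1 h2 => intro x hx; rw [mul_add]; exact add_mem (h1 x hx) (h2 x hx)
  | hm a b h1 h2 => intro x hx; rw [← mul_assoc]; exact h2 _ (h1 x hx)

theorem w_mul_mem (r : Jacobson K) : wJ K * r ∈ socJ K :=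
  socJ_mul K r _ (by simpa using wX_mem K 0)

theorem YX_eq : Yg K * Xg K = 1 - wJ K := by unfold wJ; simp

theorem c_eq : cJ K = Yg K - Yg K * wJ K := by
  unfold cJ wJ; rw [mul_sub, mul_one, pow_two, mul_assoc, sub_sub_cancel]

theorem X_mul_c : Xg K * cJ K = 1 - wJ K := by
  rw [c_eq, mul_sub, JX_mul_Y_mul, JX_mul_Y]

theorem wX_mul_c (j : ℕ) : wJ K * Xg K ^ j * cJ K = 0 ∨
    ∃ i < j, wJ K * Xg K ^ j * cJ K = wJ K * Xg K ^ i := by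
  have hXc : ∀ a, a * Xg K * cJ K = a - a * wJ K := by
    intro a; rw [mul_assoc, X_mul_c, mul_sub, mul_one]
  match j with
  | 0 => left; unfold cJ; rw [pow_zero, mul_one, pow_two, mul_assoc, ← mul_assoc, Jw_mul_Y, zero_mul]
  | 1 =>
    left
    rw [pow_one, hXc]
    conv_lhs => enter [2, 2]; rw [wJ]
    rw [mul_sub, ← mul_assoc, Jw_mul_Y]; simp
  | (j + 2) =>
    right
    refine ⟨j + 1, by omega, ?_⟩
    rw [pow_succ, ← mul_assoc, hXc, pow_succ, mul_assoc _ _ (wJ K), mul_assoc _ (Xg K) (wJ K),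
      JX_mul_w]
    simp

/-- The multiplication of w X^j by a polynomial in c. -/
theorem wX_mul_aeval (L : Submodule (Jacobson K) (Jacobson K)) (q : Polynomial K) :
    ∀ j : ℕ, (∀ i ≤ j, wJ K * Xg K ^ i ∈ L) →
      wJ K * Xg K ^ j * Polynomial.aeval (cJ K) q ∈ L := by
  have hmon : ∀ n j : ℕ, (∀ i ≤ j, wJ K * Xg K ^ i ∈ L) → wJ K * Xg K ^ j * cJ K ^ n ∈ L := by
    intro n
    induction n with
    | zero => intro j h; simpa using h j le_rfl
    | succ n ih =>
      intro j h
      rw [pow_succ', ← mul_assoc]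
      rcases wX_mul_c K j with h1 | ⟨i, hi, h1⟩
      · rw [h1, zero_mul]; exact zero_mem _
      · rw [h1]; exact ih i fun k hk => h k (by omega)
  intro j h
  induction q using Polynomial.induction_on' with
  | add p q h1 h2 => rw [map_add, mul_add]; exact add_mem h1 h2
  | monomial n a =>
    rw [Polynomial.aeval_monomial, ← mul_assoc, ← Algebra.commutes, mul_assoc]
    exact Jsub_smul K a (hmon n j h)

theorem soc_le (p : Polynomial K) (hp : p.eval 0 ≠ 0) :
    socJ K ≤ Submodule.span (Jacobson K) {Polynomial.aeval (cJ K) p} := by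
  set L := Submodule.span (Jacobson K) {Polynomial.aeval (cJ K) p} with hL
  rw [socJ_eq, Submodule.span_le]
  have key : ∀ j : ℕ, wJ K * Xg K ^ j ∈ L := by
    intro j
    induction j using Nat.strong_induction_on with
    | _ j ih =>
      have h1 : wJ K * Xg K ^ j * Polynomial.aeval (cJ K) p ∈ L :=
        L.smul_mem _ (Submodule.mem_span_singleton_self _)
      rw [← Polynomial.X_mul_divX_add p, map_add, map_mul, Polynomial.aeval_X,
        Polynomial.aeval_C, mul_add, ← mul_assoc] at h1
      have h2 : wJ K * Xg K ^ j * cJ K * Polynomial.aeval (cJ K) p.divX ∈ L := by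
        rcases wX_mul_c K j with h | ⟨i, hi, h⟩
        · rw [h, zero_mul]; exact zero_mem _
        · rw [h]; exact wX_mul_aeval K L _ i fun k hk => ih k (by omega)
      have h3 := (Submodule.add_mem_iff_right _ h2).1 h1
      rw [← Algebra.commutes] at h3
      rw [Polynomial.coeff_zero_eq_eval_zero] at h3
      have := Jsub_smul K (p.eval 0)⁻¹ h3
      rwa [← mul_assoc, ← map_mul, inv_mul_cancel₀ hp, map_one, one_mul] at this
  rintro _ ⟨j, rfl⟩
  exact key j

theorem J_normal (r : Jacobson K) : ∃ (n : ℕ) (q : Polynomial K),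
    Yg K ^ n * r - Polynomial.aeval (cJ K) q ∈ socJ K := by
  have hY : ∀ (r : Jacobson K) (q : Polynomial K), r - Polynomial.aeval (cJ K) q ∈ socJ K →
      Yg K * r - Polynomial.aeval (cJ K) (Polynomial.X * q) ∈ socJ K := by
    intro r q h
    have h1 := (socJ K).smul_mem (Yg K) h
    have h2 := (socJ K).smul_mem (Yg K) (w_mul_mem K (Polynomial.aeval (cJ K) q))
    convert add_mem h1 h2 using 1
    rw [map_mul, Polynomial.aeval_X]
    generalize Polynomial.aeval (cJ K) q = t
    rw [c_eq]; simp only [smul_eq_mul, mul_sub, sub_mul, mul_assoc]; abel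
  have hYn : ∀ (m : ℕ) (r : Jacobson K) (q : Polynomial K),
      r - Polynomial.aeval (cJ K) q ∈ socJ K →
      Yg K ^ m * r - Polynomial.aeval (cJ K) (Polynomial.X ^ m * q) ∈ socJ K := by
    intro m r q h
    induction m with
    | zero => simpa using h
    | succ m ih =>
      have := hY _ _ ih
      rwa [← mul_assoc, ← mul_assoc, ← pow_succ', ← pow_succ'] at this
  have key : ∀ s : Jacobson K,
      (∃ (n : ℕ) (q : Polynomial K), Yg K ^ n * s - Polynomial.aeval (cJ K) q ∈ socJ K) →
      ∃ (n : ℕ) (q : Polynomial K), Yg K ^ n * (r * s) - Polynomial.aeval (cJ K) q ∈ socJ K := by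
    induction r using J_induction with
    | hs a =>
      rintro s ⟨n, q, h⟩
      refine ⟨n, Polynomial.C a * q, ?_⟩
      have := Jsub_smul K a h
      rwa [mul_sub, ← mul_assoc, Algebra.commutes, mul_assoc, ← Polynomial.aeval_C (x := cJ K), ← map_mul, Polynomial.aeval_C] at this
    | hY =>
      rintro s ⟨n, q, h⟩
      refine ⟨n, Polynomial.X * q, ?_⟩
      have := hY _ _ h
      rwa [← mul_assoc, ← pow_succ', pow_succ, mul_assoc] at this
    | hX =>
      rintro s ⟨n, q, h⟩
      refine ⟨n + 1, q, ?_⟩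
      have h2 := (socJ K).smul_mem (Yg K ^ n) (w_mul_mem K s)
      convert sub_mem h h2 using 1
      rw [pow_succ, mul_assoc, ← mul_assoc (Yg K), YX_eq, smul_eq_mul, sub_mul, mul_sub, one_mul]
      abel
    | ha a b h1 h2 =>
      intro s hs
      obtain ⟨n1, q1, h1⟩ := h1 s hs
      obtain ⟨n2, q2, h2⟩ := h2 s hs
      refine ⟨n1 + n2, Polynomial.X ^ n2 * q1 + Polynomial.X ^ n1 * q2, ?_⟩
      have h3 := add_mem (hYn n2 _ _ h1) (hYn n1 _ _ h2)
      rw [← mul_assoc (Yg K ^ n2), ← mul_assoc (Yg K ^ n1), ← pow_add, ← pow_add, add_comm n2] at h3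
      convert h3 using 1
      rw [map_add, add_mul, mul_add]
      abel
    | hm a b h1 h2 =>
      intro s hs
      obtain ⟨n, q, h⟩ := h1 _ (h2 s hs)
      exact ⟨n, q, by rwa [mul_assoc]⟩
  simpa using key 1 ⟨0, 1, by simp⟩

theorem XnYn (n : ℕ) : Xg K ^ n * Yg K ^ n = 1 := by
  induction n with
  | zero => simp
  | succ n ih => rw [pow_succ, pow_succ', mul_assoc, JX_mul_Y_mul, ih]

theorem soc_compl (I : Submodule (Jacobson K) (Jacobson K)) :
    ∃ B : Submodule (Jacobson K) (Jacobson K), B ≤ socJ K ∧ I ⊓ B = ⊥ ∧ I ⊔ B = I ⊔ socJ K := by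
  have := (isSemisimpleModule_iff _ _).1 (socJ_ss K)
  obtain ⟨C, hC⟩ := exists_isCompl (I.comap (socJ K).subtype)
  have hCJ : C.map (socJ K).subtype ≤ socJ K := Submodule.map_subtype_le _ _
  refine ⟨C.map (socJ K).subtype, hCJ, ?_, ?_⟩
  · rw [eq_bot_iff]
    rintro x ⟨hx, ⟨y, hy, rfl⟩⟩
    have : y ∈ I.comap (socJ K).subtype ⊓ C := ⟨hx, hy⟩
    rw [hC.inf_eq_bot] at this
    simp at this
    simp [this]
  · refine le_antisymm (sup_le_sup_left hCJ _) (sup_le le_sup_left ?_)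
    intro x hx
    have : (⟨x, hx⟩ : socJ K) ∈ I.comap (socJ K).subtype ⊔ C := by rw [hC.sup_eq_top]; trivial
    obtain ⟨a, ha, b, hb, hab⟩ := Submodule.mem_sup.1 this
    refine Submodule.mem_sup.2 ⟨a, ha, b, ⟨b, hb, rfl⟩, ?_⟩
    exact congrArg Subtype.val hab

/-- Polynomials whose value at c lies in a given left ideal. -/
def polyIdeal (M : Submodule (Jacobson K) (Jacobson K)) : Ideal (Polynomial K) where
  carrier := {q | Polynomial.aeval (cJ K) q ∈ M}
  add_mem' := by
    intro a b ha hb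
    simp only [Set.mem_ofPred_eq, map_add] at *
    exact add_mem ha hb
  zero_mem' := by simp
  smul_mem' := by
    intro a b hb
    simp only [Set.mem_ofPred_eq, smul_eq_mul, map_mul] at *
    exact M.smul_mem _ hb

/-- Structure of the left ideals of the Jacobson algebra: every left ideal `I` is either a
direct summand of a principal left ideal `R·p(c)` with `p(0) ≠ 0`, or a direct summand of
the socle `J`. -/
theorem structure_of_left_ideals (I : Submodule (Jacobson K) (Jacobson K)) :
    (∃ p : Polynomial K, p.eval 0 ≠ 0 ∧
        I ≤ Submodule.span (Jacobson K) {Polynomial.aeval (cJ K) p} ∧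
        ∃ B : Submodule (Jacobson K) (Jacobson K),
          B ≤ Submodule.span (Jacobson K) {Polynomial.aeval (cJ K) p} ∧
          I ⊓ B = ⊥ ∧ I ⊔ B = Submodule.span (Jacobson K) {Polynomial.aeval (cJ K) p}) ∨
      (I ≤ socJ K ∧
        ∃ B : Submodule (Jacobson K) (Jacobson K),
          B ≤ socJ K ∧ I ⊓ B = ⊥ ∧ I ⊔ B = socJ K) := by
  obtain ⟨B, hBJ, hIB, hB⟩ := soc_compl K I
  obtain ⟨p, hp⟩ := (IsPrincipalIdealRing.principal (polyIdeal K (I ⊔ socJ K))).principal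
  have hmem : ∀ q : Polynomial K, Polynomial.aeval (cJ K) q ∈ I ⊔ socJ K ↔ p ∣ q := by
    intro q
    have : q ∈ polyIdeal K (I ⊔ socJ K) ↔ p ∣ q := by
      rw [hp]; exact Ideal.mem_span_singleton
    exact this
  have hdec : ∀ r ∈ I ⊔ socJ K, ∃ (s b : Jacobson K), b ∈ socJ K ∧
      r = s * Polynomial.aeval (cJ K) p + b := by
    intro r hr
    obtain ⟨n, q, h⟩ := J_normal K r
    have h1 : Polynomial.aeval (cJ K) q ∈ I ⊔ socJ K := by
      have := sub_mem ((I ⊔ socJ K).smul_mem (Yg K ^ n) hr) ((le_sup_right : socJ K ≤ I ⊔ socJ K) h)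
      simpa using this
    obtain ⟨t, rfl⟩ := (hmem q).1 h1
    refine ⟨Xg K ^ n * Polynomial.aeval (cJ K) t, _, (socJ K).smul_mem (Xg K ^ n) h, ?_⟩
    rw [smul_eq_mul, mul_sub, ← mul_assoc, XnYn, one_mul, mul_comm p t, map_mul, mul_assoc]
    abel
  by_cases hp0 : p = 0
  · right
    have hI : I ≤ socJ K := by
      intro r hr
      obtain ⟨s, b, hb, rfl⟩ := hdec r ((le_sup_left : I ≤ I ⊔ socJ K) hr)
      simpa [hp0] using hb
    exact ⟨hI, B, hBJ, hIB, by rw [hB]; exact sup_eq_right.2 hI⟩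
  · left
    have hpe : p.eval 0 ≠ 0 := by
      intro h0
      rw [← Polynomial.coeff_zero_eq_eval_zero] at h0
      obtain ⟨q, hq⟩ := Polynomial.X_dvd_iff.2 h0
      have h1 := (I ⊔ socJ K).smul_mem (Xg K) ((hmem p).2 dvd_rfl)
      rw [smul_eq_mul, hq, map_mul, Polynomial.aeval_X, ← mul_assoc, X_mul_c, sub_mul,
        one_mul] at h1
      have h2 := add_mem h1 ((le_sup_right : socJ K ≤ I ⊔ socJ K)
        (w_mul_mem K (Polynomial.aeval (cJ K) q)))
      rw [sub_add_cancel, hmem] at h2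
      have hq0 : q ≠ 0 := by rintro rfl; simp [hp0] at hq
      have h3 := Polynomial.natDegree_le_of_dvd h2 hq0
      rw [hq, Polynomial.natDegree_X_mul hq0] at h3
      omega
    have hsoc := soc_le K p hpe
    have hle : I ⊔ socJ K ≤ Submodule.span (Jacobson K) {Polynomial.aeval (cJ K) p} := by
      intro r hr
      obtain ⟨s, b, hb, rfl⟩ := hdec r hr
      exact add_mem (Submodule.smul_mem _ s (Submodule.mem_span_singleton_self _)) (hsoc hb)
    refine ⟨p, hpe, le_sup_left.trans hle, B, hBJ.trans hsoc, hIB, ?_⟩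
    rw [hB]
    refine le_antisymm hle ?_
    rw [Submodule.span_singleton_le_iff_mem]
    exact (hmem p).2 dvd_rfl
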